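/- arXiv:2604.03530 — 3 statements merged into one kernel-verified Lean document; each statement's English description precedes it below -/
import Mathlib

section
/- Let K ⊂ (-1,0) be a compact set. Then q^{2-n} · S_n(q) converges to the constant function 2 uniformly on K; that is, sup_{q ∈ K} |q^{2-n} S_n(q) - 2| → 0 as n → ∞. -/
open SimpleGraph Finset

noncomputable section

/-- The finset of edges of a simple graph on a finite vertex type. -/
def edgeFin {V : Type} [Finite V] (G : SimpleGraph V) : Finset (Sym2 V) :=
  (Set.toFinite G.edgeSet).toFinset

open Classical in
/-- All-terminal reliability polynomial: `relPoly G q` is the probability that the graph stays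
connected when every edge fails independently with probability `q`. -/
def relPoly {V : Type} [Finite V] (G : SimpleGraph V) (q : ℝ) : ℝ :=
  ∑ A ∈ (edgeFin G).powerset,
    if (SimpleGraph.fromEdgeSet (A : Set (Sym2 V))).Connected then
      (1 - q) ^ A.card * q ^ ((edgeFin G).card - A.card) else 0

open Classical in
/-- Split reliability polynomial with terminals `u`, `v`: the sum is over edge subsets whose
spanning subgraph has exactly two components, one containing `u` and the other containing `v`. -/
def splitRel {V : Type} [Finite V] (H : SimpleGraph V) (u v : V) (q : ℝ) : ℝ :=
  ∑ A ∈ (edgeFin H).powerset,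
    if (¬ (SimpleGraph.fromEdgeSet (A : Set (Sym2 V))).Reachable u v ∧
        ∀ w, (SimpleGraph.fromEdgeSet (A : Set (Sym2 V))).Reachable u w ∨
             (SimpleGraph.fromEdgeSet (A : Set (Sym2 V))).Reachable v w) then
      (1 - q) ^ A.card * q ^ ((edgeFin H).card - A.card) else 0

/-- The virtual edge interaction `ŷ_H = Rel(H)/S(H) + 1`. -/
def yhat {V : Type} [Finite V] (H : SimpleGraph V) (u v : V) (q : ℝ) : ℝ :=
  relPoly H q / splitRel H u v q + 1

/-- `Hgraph n` is the complete graph on `Fin n` with the edge between `0` and `1` removed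
(for `n ≥ 2`; for `n < 2` no edge is removed). -/
def Hgraph (n : ℕ) : SimpleGraph (Fin n) :=
  (⊤ : SimpleGraph (Fin n)).deleteEdges
    {e | ∃ _h : 2 ≤ n, e = s(⟨0, by omega⟩, ⟨1, by omega⟩)}

/-- `Cfun n q = Rel(K_n; q)`. -/
def Cfun (n : ℕ) (q : ℝ) : ℝ := relPoly (⊤ : SimpleGraph (Fin n)) q

/-- `Rfun n q = Rel(H_n; q)` where `H_n = K_n` minus an edge. -/
def Rfun (n : ℕ) (q : ℝ) : ℝ := relPoly (Hgraph n) q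

/-- `Sfun n q = S(H_n; q)`, the split reliability of `K_n` minus the edge `uv`,
with terminals `u`, `v` the endpoints of the deleted edge. -/
def Sfun (n : ℕ) (q : ℝ) : ℝ :=
  if h : 2 ≤ n then splitRel (Hgraph n) ⟨0, by omega⟩ ⟨1, by omega⟩ q else 0

/-- `yfun n q = ŷ_{H_n}(q)`. -/
def yfun (n : ℕ) (q : ℝ) : ℝ := Rfun n q / Sfun n q + 1

section Decomposition

variable {V : Type}

open Classical in
/-- The edges of the complete graph on the vertex set `W`. -/
def innerEdges (W : Finset V) : Finset (Sym2 V) := {e ∈ W.sym2 | ¬ e.IsDiag}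

/-- `u` and `w` are connected by edges of `A`. -/
abbrev EdgeJoined (A : Finset (Sym2 V)) (u w : V) : Prop :=
  (fromEdgeSet (A : Set (Sym2 V))).Reachable u w

open Classical in
/-- The vertices of `W` joined to `u` by edges of `A`. -/
def joinedSet (W : Finset V) (A : Finset (Sym2 V)) (u : V) : Finset V := {w ∈ W | EdgeJoined A u w}

/-- The probability that exactly the edges in `A` survive among those of `E`. -/
def edgeWeight (q : ℝ) (E A : Finset (Sym2 V)) : ℝ := (1 - q) ^ #A * q ^ (#E - #A)

open Classical in
/-- The reliability of the complete graph on `W`, seen from the vertex `u`. -/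
def cliqueRel (q : ℝ) (W : Finset V) (u : V) : ℝ :=
  ∑ A ∈ (innerEdges W).powerset with ∀ w ∈ W, EdgeJoined A u w, edgeWeight q (innerEdges W) A

theorem mk_mem_innerEdges {W : Finset V} {a b : V} :
    s(a, b) ∈ innerEdges W ↔ (a ∈ W ∧ b ∈ W) ∧ a ≠ b := by
  simp [innerEdges]

theorem card_innerEdges (W : Finset V) : #(innerEdges W) = (#W).choose 2 := by
  classical
  rw [← Sym2.card_image_offDiag]
  congr 1
  ext e
  induction e with | _ a b =>
  simp only [mk_mem_innerEdges, mem_image, mem_offDiag, Prod.exists, Function.uncurry, Sym2.eq_iff]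
  grind

theorem innerEdges_mono {X W : Finset V} (h : X ⊆ W) : innerEdges X ⊆ innerEdges W := by
  intro e
  induction e with | _ a b =>
  simp only [mk_mem_innerEdges]
  grind

theorem disjoint_innerEdges {X Y : Finset V} (h : Disjoint X Y) :
    Disjoint (innerEdges X) (innerEdges Y) := by
  rw [Finset.disjoint_left] at *
  intro e
  induction e with | _ a b =>
  simp only [mk_mem_innerEdges]
  grind

theorem choose_two_add (a b : ℕ) : (a + b).choose 2 = a.choose 2 + b.choose 2 + a * b := by
  rw [Nat.add_choose_eq]
  simp [Finset.Nat.antidiagonal_succ]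
  ring

theorem joined_mono {A B : Finset (Sym2 V)} (h : A ⊆ B) {u w : V} (hA : EdgeJoined A u w) :
    EdgeJoined B u w :=
  hA.mono (fromEdgeSet_mono (by exact_mod_cast h))

open Classical in
/-- If no edge of `A` leaves `X`, walks starting in `X` stay in `X`. -/
theorem joined_iff_of_subset_union {X Y : Finset V} (hXY : Disjoint X Y) {A : Finset (Sym2 V)}
    (hA : A ⊆ innerEdges X ∪ innerEdges Y) {u w : V} (hu : u ∈ X) :
    EdgeJoined A u w ↔ w ∈ X ∧ EdgeJoined (A ∩ innerEdges X) u w := by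
  refine ⟨fun h => ?_, fun h => joined_mono inter_subset_left h.2⟩
  rw [EdgeJoined, reachable_iff_reflTransGen] at h
  induction h with
  | refl => exact ⟨hu, Reachable.refl _⟩
  | @tail b c _ hbc ih =>
    rw [fromEdgeSet_adj, mem_coe] at hbc
    have hX : s(b, c) ∈ innerEdges X := by
      rcases mem_union.1 (hA hbc.1) with h | h
      · exact h
      · exact absurd (mk_mem_innerEdges.1 h).1.1 (Finset.disjoint_left.1 hXY ih.1)
    refine ⟨(mk_mem_innerEdges.1 hX).1.2, ih.2.trans (Adj.reachable ?_)⟩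
    rw [fromEdgeSet_adj, mem_coe]
    exact ⟨mem_inter.2 ⟨hbc.1, hX⟩, hbc.2⟩

open Classical in
theorem joinedSet_eq_iff {X Y : Finset V} (hXY : Disjoint X Y) {A : Finset (Sym2 V)}
    (hA : A ⊆ innerEdges (X ∪ Y)) {u : V} (hu : u ∈ X) :
    joinedSet (X ∪ Y) A u = X ↔
      A ⊆ innerEdges X ∪ innerEdges Y ∧ ∀ w ∈ X, EdgeJoined (A ∩ innerEdges X) u w := by
  constructor
  · intro h
    have hmem : ∀ w ∈ X ∪ Y, w ∈ X ↔ EdgeJoined A u w := fun w hw => by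
      rw [← h]; simp [joinedSet, hw]
    have hsub : A ⊆ innerEdges X ∪ innerEdges Y := by
      intro e he
      induction e with | _ a b =>
      obtain ⟨⟨ha, hb⟩, hab⟩ := mk_mem_innerEdges.1 (hA he)
      have hadj : EdgeJoined A a b := Adj.reachable (by rw [fromEdgeSet_adj]; exact ⟨he, hab⟩)
      have : a ∈ X ↔ b ∈ X := by
        rw [hmem a ha, hmem b hb]
        exact ⟨fun h => h.trans hadj, fun h => h.trans hadj.symm⟩
      simp only [mem_union, mk_mem_innerEdges] at *
      tauto
    refine ⟨hsub, fun w hw => ?_⟩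
    exact ((joined_iff_of_subset_union hXY hsub hu).1
      ((hmem w (mem_union_left _ hw)).1 hw)).2
  · rintro ⟨hsub, h⟩
    ext w
    simp only [joinedSet, mem_filter, joined_iff_of_subset_union hXY hsub hu, mem_union]
    have := h w
    tauto

open Classical in
/-- The edge sets for which the component of `u` is `X` factor over `X` and its complement. -/
theorem sum_edgeWeight_joinedSet_eq (q : ℝ) {E : Finset (Sym2 V)} {X Y : Finset V} {u : V}
    (hXY : Disjoint X Y) (hu : u ∈ X) (hX : innerEdges X ⊆ E) (hY : innerEdges Y ⊆ E)
    (hE : E ⊆ innerEdges (X ∪ Y)) (P : Finset (Sym2 V) → Prop)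
    [DecidablePred P] :
    ∑ A ∈ E.powerset with joinedSet (X ∪ Y) A u = X ∧ P (A ∩ innerEdges Y), edgeWeight q E A =
      cliqueRel q X u * (∑ B ∈ (innerEdges Y).powerset with P B, edgeWeight q (innerEdges Y) B) *
        q ^ (#E - #(innerEdges X) - #(innerEdges Y)) := by
  have hdisj := disjoint_innerEdges hXY
  have hcard : #(innerEdges X) + #(innerEdges Y) ≤ #E := by
    rw [← card_union_of_disjoint hdisj]
    exact card_le_card (union_subset hX hY)
  have hX' : ∀ A ⊆ innerEdges X, ∀ B ⊆ innerEdges Y, (A ∪ B) ∩ innerEdges X = A := by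
    intro A hA B hB
    rw [union_inter_distrib_right, inter_eq_left.2 hA,
      disjoint_iff_inter_eq_empty.1 (hdisj.symm.mono_left hB), union_empty]
  have hY' : ∀ A ⊆ innerEdges X, ∀ B ⊆ innerEdges Y, (A ∪ B) ∩ innerEdges Y = B := by
    intro A hA B hB
    rw [union_inter_distrib_right, inter_eq_left.2 hB,
      disjoint_iff_inter_eq_empty.1 (hdisj.mono_left hA), empty_union]
  rw [cliqueRel, sum_mul_sum, ← sum_product', sum_mul]
  symm
  refine sum_nbij' (fun p => p.1 ∪ p.2) (fun A => (A ∩ innerEdges X, A ∩ innerEdges Y))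
    ?_ ?_ ?_ ?_ ?_
  · rintro ⟨A, B⟩ h
    simp only [mem_product, mem_filter, mem_powerset] at h ⊢
    obtain ⟨⟨hA, hAX⟩, hB, hP⟩ := h
    have hAB : A ∪ B ⊆ E := union_subset (hA.trans hX) (hB.trans hY)
    refine ⟨hAB, ?_, by rwa [hY' A hA B hB]⟩
    rw [joinedSet_eq_iff hXY (hAB.trans hE) hu, hX' A hA B hB]
    exact ⟨union_subset_union hA hB, hAX⟩
  · intro A h
    simp only [mem_product, mem_filter, mem_powerset] at h ⊢
    exact ⟨⟨inter_subset_right, ((joinedSet_eq_iff hXY (h.1.trans hE) hu).1 h.2.1).2⟩,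
      inter_subset_right, h.2.2⟩
  · rintro ⟨A, B⟩ h
    simp only [mem_product, mem_filter, mem_powerset] at h ⊢
    rw [hX' A h.1.1 B h.2.1, hY' A h.1.1 B h.2.1]
  · intro A h
    simp only [mem_filter, mem_powerset] at h
    have := ((joinedSet_eq_iff hXY (h.1.trans hE) hu).1 h.2.1).1
    rw [← inter_union_distrib_left, inter_eq_left.2 this]
  · rintro ⟨A, B⟩ h
    simp only [mem_product, mem_filter, mem_powerset] at h
    have hA := card_le_card h.1.1
    have hB := card_le_card h.2.1
    simp only [edgeWeight]
    rw [card_union_of_disjoint ((hdisj.mono_left h.1.1).mono_right h.2.1),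
      show #E - (#A + #B) = (#(innerEdges X) - #A) + (#(innerEdges Y) - #B) +
        (#E - #(innerEdges X) - #(innerEdges Y)) by omega]
    ring

open Classical in
theorem sum_cliqueRel_mul_pow (q : ℝ) {W : Finset V} {u : V} (hu : u ∈ W) :
    ∑ X ∈ W.powerset with u ∈ X, cliqueRel q X u * q ^ (#X * (#W - #X)) = 1 := by
  have htotal (E : Finset (Sym2 V)) : ∑ A ∈ E.powerset, edgeWeight q E A = 1 := by
    simp [edgeWeight, sum_pow_mul_eq_add_pow]
  rw [← htotal (innerEdges W),
    ← sum_fiberwise_of_maps_to (t := {X ∈ W.powerset | u ∈ X}) (g := fun A => joinedSet W A u)]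
  · refine sum_congr rfl fun X hX => ?_
    obtain ⟨hXW, huX⟩ := mem_filter.1 hX
    rw [mem_powerset] at hXW
    have h := sum_edgeWeight_joinedSet_eq q (E := innerEdges W) (disjoint_sdiff (s := X) (t := W))
      huX (innerEdges_mono hXW) (innerEdges_mono sdiff_subset)
      (by rw [union_sdiff_of_subset hXW]) (fun _ => True)
    simp only [and_true, filter_true, htotal, mul_one, union_sdiff_of_subset hXW] at h
    rw [h]
    congr 2
    have hc := card_sdiff_add_card_eq_card hXW
    have h2 := choose_two_add (#X) (#(W \ X))
    rw [add_comm (#X), hc] at h2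
    simp only [card_innerEdges]
    rw [show #W - #X = #(W \ X) by omega]
    omega
  · intro A _
    simp [joinedSet, filter_subset, hu, EdgeJoined]

open Classical in
theorem edgeFin_top_deleteEdges [Fintype V] (e : Sym2 V) :
    edgeFin ((⊤ : SimpleGraph V).deleteEdges {e}) = (innerEdges univ).erase e := by
  ext f
  induction f with | _ a b =>
  simp [edgeFin, mk_mem_innerEdges, and_comm]

open Classical in
/-- The split reliability of the complete graph minus `uv`, indexed by the component of `u`. -/
theorem splitRel_eq_sum [Fintype V] {u v : V} (huv : u ≠ v) (q : ℝ) :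
    splitRel ((⊤ : SimpleGraph V).deleteEdges {s(u, v)}) u v q =
      ∑ Z ∈ (univ \ {u, v} : Finset V).powerset,
      cliqueRel q (insert u Z) u * cliqueRel q (insert v ((univ \ {u, v}) \ Z)) v *
        q ^ (#Z * (#(univ \ {u, v} : Finset V) - #Z) + #(univ \ {u, v} : Finset V)) := by
  set M : Finset V := univ \ {u, v} with hM
  set E := (innerEdges (univ : Finset V)).erase s(u, v) with hE
  have hEcard : #E + 1 = (#M + 2).choose 2 := by
    have h1 : s(u, v) ∈ innerEdges (univ : Finset V) := by simp [mk_mem_innerEdges, huv]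
    have h2 : #M + 2 = #(univ : Finset V) := by
      rw [hM, ← card_pair huv]
      exact card_sdiff_add_card_eq_card (subset_univ _)
    rw [hE, card_erase_add_one h1, card_innerEdges, h2]
  have hsplit : splitRel ((⊤ : SimpleGraph V).deleteEdges {s(u, v)}) u v q = ∑ A ∈ E.powerset with
      ¬ EdgeJoined A u v ∧ ∀ w, EdgeJoined A u w ∨ EdgeJoined A v w, edgeWeight q E A := by
    rw [splitRel, sum_filter, edgeFin_top_deleteEdges]
    refine sum_congr rfl fun A _ => ?_
    congr
  rw [hsplit]
  rw [← sum_fiberwise_of_maps_to (t := M.powerset)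
    (g := fun A => (joinedSet univ A u).erase u)]
  · refine sum_congr rfl fun Z hZ => ?_
    rw [mem_powerset] at hZ
    have huZ : u ∉ Z := fun h => by simpa [hM] using hZ h
    have hvZ : v ∉ Z := fun h => by simpa [hM] using hZ h
    have hunion : insert u Z ∪ insert v (M \ Z) = univ := by
      ext w; simp [hM]; tauto
    have hdisj : Disjoint (insert u Z) (insert v (M \ Z)) := by
      rw [Finset.disjoint_left]; intro w; simp [hM]; grind
    have hsub : ∀ X : Finset V, (u ∉ X ∨ v ∉ X) → innerEdges X ⊆ E := by
      intro X hX e he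
      refine mem_erase.2 ⟨?_, innerEdges_mono (subset_univ _) he⟩
      rintro rfl
      have := (mk_mem_innerEdges.1 he).1
      tauto
    have h := sum_edgeWeight_joinedSet_eq q (E := E) hdisj (mem_insert_self u Z)
      (hsub _ (Or.inr (by simp [hvZ, huv.symm]))) (hsub _ (Or.inl (by simp [hM, huv])))
      (by rw [hunion]; exact erase_subset _ _)
      (fun B => ∀ w ∈ insert v (M \ Z), EdgeJoined B v w)
    have hexp : #E - #(innerEdges (insert u Z)) - #(innerEdges (insert v (M \ Z))) =
        #Z * (#M - #Z) + #M := by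
      have hc := card_sdiff_add_card_eq_card hZ
      simp only [card_innerEdges, card_insert_of_notMem huZ,
        card_insert_of_notMem (show v ∉ M \ Z by simp [hM])]
      have h2 := choose_two_add (#Z + 1) (#(M \ Z) + 1)
      rw [show #Z + 1 + (#(M \ Z) + 1) = #M + 2 by omega, ← hEcard] at h2
      rw [show #M - #Z = #(M \ Z) by omega]
      have h3 : (#Z + 1) * (#(M \ Z) + 1) = #Z * #(M \ Z) + #M + 1 := by rw [← hc]; ring
      omega
    rw [hexp, hunion] at h
    refine Eq.trans ?_ (h.trans (by rw [cliqueRel.eq_def q (insert v (M \ Z))]; congr!))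
    rw [filter_filter]
    refine sum_congr (filter_congr fun A hA => ?_) fun _ _ => rfl
    have huJ : u ∈ joinedSet univ A u := by simp [joinedSet]
    have hset : (joinedSet univ A u).erase u = Z ↔ joinedSet univ A u = insert u Z :=
      ⟨fun h => by rw [← h, insert_erase huJ], fun h => by rw [h, erase_insert huZ]⟩
    rw [hset, and_comm]
    refine and_congr_right fun hJ => ?_
    have hAsub : A ⊆ innerEdges (insert u Z ∪ insert v (M \ Z)) := by
      rw [hunion]; exact (mem_powerset.1 hA).trans (erase_subset _ _)
    have hAE := ((joinedSet_eq_iff hdisj hAsub (mem_insert_self u Z)).1 (by rwa [hunion])).1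
    have hmem : ∀ w, EdgeJoined A u w ↔ w ∈ insert u Z := fun w => by
      rw [← hJ]; simp [joinedSet]
    have hmem' : ∀ w, w ∈ insert v (M \ Z) ↔ w ∉ insert u Z := fun w => by
      simp [hM]; grind
    have hv := fun w => joined_iff_of_subset_union (w := w) hdisj.symm
      (show A ⊆ _ by rwa [union_comm]) (mem_insert_self v (M \ Z))
    simp only [EdgeJoined] at hmem hv ⊢
    simp only [hmem, hv, hmem']
    have : v ∉ insert u Z := by simp [hvZ, huv.symm]
    constructor
    · rintro ⟨-, h⟩ w hw
      have := h w
      tauto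
    · intro h
      refine ⟨this, fun w => ?_⟩
      have := h w
      tauto
  · intro A hA
    simp only [mem_powerset, hM, subset_iff, mem_erase, joinedSet, mem_filter, mem_univ, true_and,
      mem_sdiff, mem_insert, mem_singleton] at hA ⊢
    rintro w ⟨hwu, hw⟩ (rfl | rfl)
    · exact hwu rfl
    · exact hA.2.1 hw

end Decomposition

section Estimates

open Filter

/-- A bound for `∑ (t ^ 2) ^ (#Z * (m - #Z))` over nonempty proper subsets `Z` of an `m`-set. -/
def splitBound (t : ℝ) (m : ℕ) : ℝ := 2 * ((1 + t ^ m) ^ m - 1)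

theorem tendsto_splitBound {t : ℝ} (ht0 : 0 ≤ t) (ht1 : t < 1) :
    Tendsto (splitBound t) atTop (nhds 0) := by
  have h : Tendsto (fun m : ℕ => 2 * (Real.exp (m * t ^ m) - 1)) atTop (nhds 0) := by
    have := tendsto_self_mul_const_pow_of_abs_lt_one (r := t) (by rwa [abs_of_nonneg ht0])
    simpa using ((this.rexp).sub_const 1).const_mul 2
  refine squeeze_zero (fun m => ?_) (fun m => ?_) h
  · have : (1 : ℝ) ≤ (1 + t ^ m) ^ m := one_le_pow₀ (by linarith [pow_nonneg ht0 m])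
    unfold splitBound
    linarith
  · have h1 : (1 + t ^ m) ^ m ≤ Real.exp (m * t ^ m) := by
      rw [Real.exp_nat_mul]
      exact pow_le_pow_left₀ (by linarith [pow_nonneg ht0 m])
        (by linarith [Real.add_one_le_exp (t ^ m)]) m
    unfold splitBound
    linarith

theorem splitBound_nonneg {t : ℝ} (ht0 : 0 ≤ t) (m : ℕ) : 0 ≤ splitBound t m := by
  have : (1 : ℝ) ≤ (1 + t ^ m) ^ m := one_le_pow₀ (by linarith [pow_nonneg ht0 m])
  unfold splitBound
  linarith

theorem sq_pow_mul_sub_le {t : ℝ} (ht0 : 0 ≤ t) (ht1 : t ≤ 1) {z m : ℕ} (hz : z ≤ m) :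
    (t ^ 2) ^ (z * (m - z)) ≤ (t ^ m) ^ z + (t ^ m) ^ (m - z) := by
  obtain ⟨k, rfl⟩ := Nat.exists_eq_add_of_le hz
  rw [Nat.add_sub_cancel_left, ← pow_mul, ← pow_mul, ← pow_mul]
  rcases le_total z k with h | h
  · have : t ^ (2 * (z * k)) ≤ t ^ ((z + k) * z) := pow_le_pow_of_le_one ht0 ht1 (by nlinarith)
    linarith [pow_nonneg ht0 ((z + k) * k)]
  · have : t ^ (2 * (z * k)) ≤ t ^ ((z + k) * k) := pow_le_pow_of_le_one ht0 ht1 (by nlinarith)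
    linarith [pow_nonneg ht0 ((z + k) * z)]

variable {V : Type}

open Classical in
theorem sum_pow_le_splitBound {t : ℝ} (ht0 : 0 ≤ t) (ht1 : t ≤ 1) (M : Finset V) :
    ∑ Z ∈ (M.powerset.erase ∅).erase M, (t ^ 2) ^ (#Z * (#M - #Z)) ≤ splitBound t #M := by
  have hs : 0 ≤ t ^ #M := pow_nonneg ht0 _
  calc ∑ Z ∈ (M.powerset.erase ∅).erase M, (t ^ 2) ^ (#Z * (#M - #Z))
      ≤ ∑ Z ∈ (M.powerset.erase ∅).erase M, ((t ^ #M) ^ #Z + (t ^ #M) ^ (#M - #Z)) :=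
        sum_le_sum fun Z hZ => sq_pow_mul_sub_le ht0 ht1
          (card_le_card (mem_powerset.1 (mem_of_mem_erase (mem_of_mem_erase hZ))))
    _ ≤ ∑ Z ∈ M.powerset.erase ∅, (t ^ #M) ^ #Z +
          ∑ Z ∈ M.powerset.erase M, (t ^ #M) ^ (#M - #Z) := by
        rw [sum_add_distrib]
        refine add_le_add ?_ ?_
        · exact sum_le_sum_of_subset_of_nonneg (erase_subset _ _) fun _ _ _ => pow_nonneg hs _
        · exact sum_le_sum_of_subset_of_nonneg (erase_subset_erase _ (erase_subset _ _))
            fun _ _ _ => pow_nonneg hs _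
    _ = splitBound t #M := by
        have h1 := sum_pow_mul_eq_add_pow (t ^ #M) 1 M
        have h2 := sum_pow_mul_eq_add_pow 1 (t ^ #M) M
        rw [← add_sum_erase _ _ (empty_mem_powerset M)] at h1
        rw [← add_sum_erase _ _ (mem_powerset_self M)] at h2
        simp only [one_pow, mul_one, one_mul, card_empty, pow_zero, tsub_self] at h1 h2
        rw [add_comm (t ^ #M)] at h1
        rw [splitBound]
        linarith

theorem abs_cliqueRel_sub_one_le {t q B : ℝ} (ht0 : 0 ≤ t) (ht1 : t ≤ 1) (hq : |q| ≤ t ^ 2)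
    (hB : 0 ≤ B) {W : Finset V} {u : V} (hu : u ∈ W)
    (h : ∀ X ⊂ W, u ∈ X → |cliqueRel q X u| ≤ B) :
    |cliqueRel q W u - 1| ≤ B * splitBound t #W := by
  classical
  have hsum := sum_cliqueRel_mul_pow q hu
  rw [← add_sum_erase _ _ (show W ∈ W.powerset.filter (u ∈ ·) by simp [hu])] at hsum
  simp only [tsub_self, mul_zero, pow_zero, mul_one] at hsum
  rw [show cliqueRel q W u - 1 = -∑ X ∈ (W.powerset.filter (u ∈ ·)).erase W,
    cliqueRel q X u * q ^ (#X * (#W - #X)) by linarith, abs_neg]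
  calc _ ≤ ∑ X ∈ (W.powerset.filter (u ∈ ·)).erase W,
        |cliqueRel q X u * q ^ (#X * (#W - #X))| := abs_sum_le_sum_abs _ _
    _ ≤ ∑ X ∈ (W.powerset.filter (u ∈ ·)).erase W, B * (t ^ 2) ^ (#X * (#W - #X)) := by
        refine sum_le_sum fun X hX => ?_
        simp only [mem_erase, mem_filter, mem_powerset] at hX
        rw [abs_mul, abs_pow]
        exact mul_le_mul (h X (Finset.ssubset_iff_subset_ne.2 ⟨hX.2.1, hX.1⟩) hX.2.2)
          (pow_le_pow_left₀ (abs_nonneg q) hq _) (by positivity) hB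
    _ ≤ ∑ X ∈ (W.powerset.erase ∅).erase W, B * (t ^ 2) ^ (#X * (#W - #X)) := by
        refine sum_le_sum_of_subset_of_nonneg (erase_subset_erase _ fun X hX => ?_)
          fun _ _ _ => by positivity
        rw [mem_filter] at hX
        exact mem_erase.2 ⟨ne_empty_of_mem hX.2, hX.1⟩
    _ ≤ B * splitBound t #W := by
        rw [← mul_sum]
        exact mul_le_mul_of_nonneg_left (sum_pow_le_splitBound ht0 ht1 W) hB

theorem cliqueRel_singleton (q : ℝ) (u : V) : cliqueRel q {u} u = 1 := by
  classical
  have h := sum_cliqueRel_mul_pow q (mem_singleton_self u)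
  rw [show (({u} : Finset V).powerset.filter (u ∈ ·)) = {{u}} by
    ext X; simp only [mem_filter, mem_powerset, subset_singleton_iff, mem_singleton]; grind] at h
  simpa using h

theorem exists_abs_cliqueRel_le {t : ℝ} (ht0 : 0 ≤ t) (ht1 : t < 1) :
    ∃ B : ℝ, 0 ≤ B ∧ ∀ (V : Type) (q : ℝ), |q| ≤ t ^ 2 → ∀ (W : Finset V), ∀ u ∈ W,
      |cliqueRel q W u| ≤ B := by
  obtain ⟨E, hE⟩ := (tendsto_splitBound ht0 ht1).bddAbove_range
  have hE' (m : ℕ) : splitBound t m ≤ E := hE ⟨m, rfl⟩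
  obtain ⟨N, hN⟩ := eventually_atTop.1
    ((tendsto_splitBound ht0 ht1).eventually_le_const (show (0 : ℝ) < 1 / 2 by norm_num))
  have hsmall : ∀ N : ℕ, ∃ B : ℝ, 2 ≤ B ∧ ∀ (V : Type) (q : ℝ), |q| ≤ t ^ 2 →
      ∀ (W : Finset V), ∀ u ∈ W, #W ≤ N → |cliqueRel q W u| ≤ B := by
    intro N
    induction N with
    | zero =>
      refine ⟨2, le_rfl, fun V q _ W u hu hW => ?_⟩
      rw [Nat.le_zero, card_eq_zero] at hW
      simp [hW] at hu
    | succ N ih =>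
      obtain ⟨B, hB2, hB⟩ := ih
      refine ⟨max B (1 + B * E), le_max_of_le_left hB2, fun V q hq W u hu hW => ?_⟩
      have h := abs_cliqueRel_sub_one_le ht0 ht1.le hq (by linarith : 0 ≤ B) hu
        fun X hX huX => hB V q hq X u huX (by have := card_lt_card hX; omega)
      have h1 := abs_le.1 (h.trans (mul_le_mul_of_nonneg_left (hE' #W) (by linarith)))
      exact le_max_of_le_right (abs_le.2 ⟨by linarith, by linarith⟩)
  obtain ⟨B, hB2, hB⟩ := hsmall N
  refine ⟨B, by linarith, fun V q hq W => ?_⟩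
  induction W using Finset.strongInduction with
  | H W ih =>
    intro u hu
    rcases le_total #W N with hW | hW
    · exact hB V q hq W u hu hW
    · have h := abs_cliqueRel_sub_one_le ht0 ht1.le hq (by linarith : 0 ≤ B) hu
        fun X hX huX => ih X hX u huX
      have h1 := abs_le.1 (h.trans (mul_le_mul_of_nonneg_left (hN #W hW) (by linarith)))
      exact abs_le.2 ⟨by linarith, by linarith⟩

open Classical in
theorem abs_zpow_mul_splitRel_sub_two_le [Fintype V] {t q B : ℝ} (ht0 : 0 ≤ t) (ht1 : t < 1)
    (hq : |q| ≤ t ^ 2) (hq0 : q ≠ 0) (hB : 0 ≤ B)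
    (hrel : ∀ (W : Finset V), ∀ u ∈ W, |cliqueRel q W u| ≤ B) {m : ℕ} (hm : 1 ≤ m)
    (hV : Fintype.card V = m + 2) {u v : V} (huv : u ≠ v) :
    |q ^ (2 - ((m + 2 : ℕ) : ℤ)) *
        splitRel ((⊤ : SimpleGraph V).deleteEdges {s(u, v)}) u v q - 2| ≤
      2 * B * splitBound t (m + 1) + B ^ 2 * splitBound t m := by
  set M : Finset V := univ \ {u, v} with hMdef
  have hM : #M = m := by
    have := card_sdiff_add_card_eq_card (subset_univ ({u, v} : Finset V))
    rw [card_pair huv, card_univ, hV] at this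
    exact Nat.add_right_cancel this
  have huM : u ∉ M := by simp [hMdef]
  have hvM : v ∉ M := by simp [hMdef]
  set F : Finset V → ℝ := fun Z =>
    cliqueRel q (insert u Z) u * cliqueRel q (insert v (M \ Z)) v * q ^ (#Z * (m - #Z)) with hF
  have hsum : q ^ (2 - ((m + 2 : ℕ) : ℤ)) *
      splitRel ((⊤ : SimpleGraph V).deleteEdges {s(u, v)}) u v q = ∑ Z ∈ M.powerset, F Z := by
    have hpow : q ^ (2 - ((m + 2 : ℕ) : ℤ)) = (q ^ m)⁻¹ := by
      rw [show (2 - ((m + 2 : ℕ) : ℤ)) = -(m : ℤ) by push_cast; ring, zpow_neg, zpow_natCast]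
    rw [splitRel_eq_sum huv, mul_sum, hpow]
    refine sum_congr rfl fun Z _ => ?_
    rw [hF, ← hMdef, hM, pow_add]
    field_simp
  have hne : M ≠ ∅ := by
    rintro h
    rw [h, card_empty] at hM
    omega
  rw [hsum, ← add_sum_erase _ _ (empty_mem_powerset M),
    ← add_sum_erase _ _ (mem_erase.2 ⟨hne, mem_powerset_self M⟩)]
  have hclique : ∀ w ∉ M, |cliqueRel q (insert w M) w - 1| ≤ B * splitBound t (m + 1) := by
    intro w hw
    rw [← hM, ← card_insert_of_notMem hw]
    exact abs_cliqueRel_sub_one_le ht0 ht1.le hq hB (mem_insert_self w M) fun X _ hX => hrel X w hX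
  have hF0 : F ∅ = cliqueRel q (insert v M) v := by simp [hF, cliqueRel_singleton]
  have hFM : F M = cliqueRel q (insert u M) u := by simp [hF, cliqueRel_singleton, hM]
  have hrest : |∑ Z ∈ (M.powerset.erase ∅).erase M, F Z| ≤ B ^ 2 * splitBound t m := by
    calc _ ≤ ∑ Z ∈ (M.powerset.erase ∅).erase M, |F Z| := abs_sum_le_sum_abs _ _
      _ ≤ ∑ Z ∈ (M.powerset.erase ∅).erase M, B ^ 2 * (t ^ 2) ^ (#Z * (#M - #Z)) := by
          refine sum_le_sum fun Z _ => ?_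
          rw [hF, abs_mul, abs_mul, abs_pow, sq B, hM]
          exact mul_le_mul (mul_le_mul (hrel _ _ (mem_insert_self _ _))
            (hrel _ _ (mem_insert_self _ _)) (abs_nonneg _) hB)
            (pow_le_pow_left₀ (abs_nonneg q) hq _) (by positivity) (by positivity)
      _ ≤ B ^ 2 * splitBound t m := by
          rw [← mul_sum]
          simpa only [hM] using
            mul_le_mul_of_nonneg_left (sum_pow_le_splitBound ht0 ht1.le M) (sq_nonneg B)
  rw [hF0, hFM]
  have h1 := abs_le.1 (hclique u huM)
  have h2 := abs_le.1 (hclique v hvM)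
  have h3 := abs_le.1 hrest
  exact abs_le.2 ⟨by linarith, by linarith⟩

end Estimates

theorem Hgraph_eq_deleteEdges {n : ℕ} (hn : 2 ≤ n) :
    Hgraph n = (⊤ : SimpleGraph (Fin n)).deleteEdges {s(⟨0, by omega⟩, ⟨1, by omega⟩)} := by
  rw [Hgraph]
  congr 1
  ext e
  exact ⟨fun ⟨_, h⟩ => h, fun h => ⟨hn, h⟩⟩

open Filter in
/-- `q^{2-n} S_n(q) → 2` uniformly on any compact `K ⊂ (-1, 0)`. -/
theorem sfun_tendsto_two (K : Set ℝ) (hKc : IsCompact K) (hK : K ⊆ Set.Ioo (-1 : ℝ) 0) :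
    Tendsto (fun n : ℕ => ⨆ q ∈ K, |q ^ (2 - (n : ℤ)) * Sfun n q - 2|) atTop (nhds 0) := by
  obtain ⟨r, hr0, hr1, hr⟩ : ∃ r : ℝ, 0 ≤ r ∧ r < 1 ∧ ∀ q ∈ K, |q| ≤ r := by
    rcases K.eq_empty_or_nonempty with rfl | hne
    · exact ⟨0, le_rfl, one_pos, by simp⟩
    · obtain ⟨x, hx, hmax⟩ := hKc.exists_isMaxOn hne continuous_abs.continuousOn
      have := hK hx
      exact ⟨|x|, abs_nonneg x, abs_lt.2 ⟨this.1, by linarith [this.2]⟩, fun q hq => hmax hq⟩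
  set t := √r
  have ht0 : 0 ≤ t := Real.sqrt_nonneg r
  have ht1 : t < 1 := by rw [Real.sqrt_lt' one_pos]; simpa using hr1
  have ht2 : t ^ 2 = r := Real.sq_sqrt hr0
  obtain ⟨B, hB, hrel⟩ := exists_abs_cliqueRel_le ht0 ht1
  have hlim : Tendsto (fun m : ℕ => 2 * B * splitBound t (m + 1) + B ^ 2 * splitBound t m)
      atTop (nhds 0) := by
    have h := tendsto_splitBound ht0 ht1
    simpa using ((h.comp (tendsto_add_atTop_nat 1)).const_mul (2 * B)).add (h.const_mul (B ^ 2))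
  rw [← tendsto_add_atTop_iff_nat 2]
  refine tendsto_of_tendsto_of_tendsto_of_le_of_le' tendsto_const_nhds hlim
    (Eventually.of_forall fun m => Real.iSup_nonneg fun q => Real.iSup_nonneg fun _ => abs_nonneg _)
    ((eventually_ge_atTop 1).mono fun m hm => ?_)
  have hbound : 0 ≤ 2 * B * splitBound t (m + 1) + B ^ 2 * splitBound t m := by
    have := splitBound_nonneg ht0 (m + 1)
    have := splitBound_nonneg ht0 m
    positivity
  refine Real.iSup_le (fun q => Real.iSup_le (fun hq => ?_) hbound) hbound
  have hqr : |q| ≤ t ^ 2 := ht2 ▸ hr q hq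
  rw [Sfun, dif_pos (by omega), Hgraph_eq_deleteEdges (by omega)]
  exact abs_zpow_mul_splitRel_sub_two_le ht0 ht1 hqr (hK hq).2.ne hB (hrel _ q hqr) hm
    (Fintype.card_fin _) (by simp)

end
end

section
/- For every real number q, the all-terminal reliability polynomial of H_5 (the complete graph K_5 with one edge removed) satisfies Rel(H_5;q) = (1-q)^4 · (18q^5 + 24q^4 + 18q^3 + 10q^2 + 4q + 1). -/
open SimpleGraph Finset

noncomputable section

/-- A set of vertices, given by its indicator `f`, is not separated by the edge `e`. -/
def Uncut {V : Type} (f : V → Bool) (e : Sym2 V) : Prop :=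
  Sym2.lift ⟨fun a b => f a = f b, fun _ _ => propext eq_comm⟩ e

instance {V : Type} (f : V → Bool) (e : Sym2 V) : Decidable (Uncut f e) :=
  Quot.recOnSubsingleton e fun p => inferInstanceAs (Decidable (f p.1 = f p.2))

/-- A graph is connected iff every vertex set without boundary is trivial. -/
theorem connected_fromEdgeSet_iff {V : Type} (r : V) (A : Finset (Sym2 V)) :
    (fromEdgeSet (A : Set (Sym2 V))).Connected ↔
      ∀ f : V → Bool, (∀ e ∈ A, Uncut f e) → ∀ v, f v = f r := by
  classical
  constructor
  · intro h f hf v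
    obtain ⟨w⟩ := h.preconnected v r
    induction w with
    | nil => rfl
    | cons hadj _ ih =>
      rw [fromEdgeSet_adj] at hadj
      exact (show f _ = f _ from hf _ (mem_coe.1 hadj.1)).trans ih
  · intro h
    have reach (v : V) : (fromEdgeSet (A : Set (Sym2 V))).Reachable r v := by
      have key := h (fun v => decide ((fromEdgeSet (A : Set (Sym2 V))).Reachable r v)) (by
        intro e he
        induction e using Sym2.ind with
        | _ a b =>
          refine decide_eq_decide.2 ?_
          by_cases hab : a = b
          · rw [hab]
          · have hadj : (fromEdgeSet (A : Set (Sym2 V))).Adj a b :=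
              (fromEdgeSet_adj _).2 ⟨mem_coe.2 he, hab⟩
            exact ⟨fun h => h.trans hadj.reachable, fun h => h.trans hadj.symm.reachable⟩) v
      exact (decide_eq_decide.1 key).2 (Reachable.refl r)
    have : Nonempty V := ⟨r⟩
    exact ⟨fun u v => (reach u).symm.trans (reach v)⟩

/-- The reliability polynomial in terms of the numbers of connected spanning subgraphs
with a given number of edges. -/
theorem relPoly_eq_sum_card {V : Type} [Finite V] (G : SimpleGraph V) (q : ℝ)
    (P : Finset (Sym2 V) → Prop) [DecidablePred P]
    (hP : ∀ A : Finset (Sym2 V), (fromEdgeSet (A : Set (Sym2 V))).Connected ↔ P A) :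
    relPoly G q = ∑ k ∈ range ((edgeFin G).card + 1),
      (#{A ∈ (edgeFin G).powersetCard k | P A} : ℝ) *
        ((1 - q) ^ k * q ^ ((edgeFin G).card - k)) := by
  classical
  rw [relPoly, sum_powerset]
  refine sum_congr rfl fun k _ => ?_
  rw [← nsmul_eq_mul, ← sum_const, sum_filter]
  refine sum_congr rfl fun A hA => ?_
  rw [(mem_powersetCard.1 hA).2]
  exact if_congr (hP A) rfl rfl

/-- The edges of `K_5` minus an edge. -/
def edgesH5 : Finset (Sym2 (Fin 5)) :=
  {s(0, 2), s(0, 3), s(0, 4), s(1, 2), s(1, 3), s(1, 4), s(2, 3), s(2, 4), s(3, 4)}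

theorem edgeFin_Hgraph_five : edgeFin (Hgraph 5) = edgesH5 := by
  ext e
  induction e using Sym2.ind with
  | _ a b =>
    simp only [edgeFin, Hgraph, Set.Finite.mem_toFinset, mem_edgeSet, deleteEdges_adj, top_adj,
      Set.mem_ofPred_eq]
    revert a b
    decide

/-- The indicator on `Fin 5` with the binary digits of `m` as values. -/
def bits (m : ℕ) (i : Fin 5) : Bool := m.testBit i

/-- No nontrivial vertex subset (up to complement) is without boundary in `A`. -/
def CutFree (A : Finset (Sym2 (Fin 5))) : Prop :=
  ∀ m ∈ Finset.Ico 1 16, ¬ ∀ e ∈ A, Uncut (bits m) e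

instance : DecidablePred CutFree := fun A =>
  inferInstanceAs (Decidable (∀ m ∈ Finset.Ico 1 16, ¬ ∀ e ∈ A, Uncut (bits m) e))

theorem connected_fin_five_iff (A : Finset (Sym2 (Fin 5))) :
    (fromEdgeSet (A : Set (Sym2 (Fin 5)))).Connected ↔ CutFree A := by
  rw [connected_fromEdgeSet_iff 4]
  constructor
  · intro h m hm hA
    have hbits : ∀ m ∈ Finset.Ico 1 16, ¬ ∀ v, bits m v = bits m 4 := by decide
    exact hbits m hm (h _ hA)
  · intro h f hf
    by_contra hne
    have hbits : ∀ g : Fin 5 → Bool, (¬ ∀ v, g v = g 4) →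
        ∃ m ∈ Finset.Ico 1 16, ∀ a b, g a = g b → bits m a = bits m b := by
      decide
    obtain ⟨m, hm, hg⟩ := hbits f hne
    refine h m hm fun e he => ?_
    have := hf e he
    induction e using Sym2.ind with
    | _ a b => exact hg a b this

theorem card_connected_H5 :
    (List.range 10).map (fun k => #{A ∈ edgesH5.powersetCard k | CutFree A}) =
      [0, 0, 0, 0, 75, 111, 82, 36, 9, 1] := by
  decide +kernel

/-- Explicit formula for the reliability polynomial of `H_5 = K_5` minus an edge. -/
theorem rel_H5 (q : ℝ) :
    Rfun 5 q = (1 - q) ^ 4 * (18 * q ^ 5 + 24 * q ^ 4 + 18 * q ^ 3 + 10 * q ^ 2 + 4 * q + 1) := by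
  have hcard : edgesH5.card = 9 := rfl
  have hcount := card_connected_H5
  simp only [List.range_succ, List.range_zero, List.nil_append, List.cons_append, List.map_cons,
    List.map_nil, List.cons.injEq, and_true] at hcount
  obtain ⟨h0, h1, h2, h3, h4, h5, h6, h7, h8, h9⟩ := hcount
  rw [Rfun, relPoly_eq_sum_card _ q _ connected_fin_five_iff, edgeFin_Hgraph_five, hcard]
  simp only [sum_range_succ, range_zero, sum_empty, h0, h1, h2, h3, h4, h5, h6, h7, h8, h9]
  push_cast
  ring

end
end

section
/- For every real number q, the split reliability polynomial of H_5 (the complete graph K_5 with one edge uv removed, with terminals u and v) satisfies S(H_5;q) = 2q^3 · (1-q)^3 · (12q^3 + 9q^2 + 3q + 1). -/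
open SimpleGraph Finset

noncomputable section

/-- A sum over the subsets of the entries of a duplicate-free list is a sum over its sublists. -/
theorem sum_powerset_toFinset {α M : Type*} [DecidableEq α] [AddCommMonoid M] (l : List α)
    (hl : l.Nodup) (f : Finset α → M) :
    ∑ A ∈ l.toFinset.powerset, f A = (l.sublists'.map fun t => f t.toFinset).sum := by
  induction l generalizing f with
  | nil => simp
  | cons a l ih =>
    obtain ⟨ha, hl⟩ := List.nodup_cons.mp hl
    rw [List.toFinset_cons, Finset.sum_powerset_insert (by simpa using ha), ih hl f,
      ih hl fun A => f (insert a A)]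
    simp [Function.comp_def]

/-- Two vertices are separated and together reach everything, phrased through two-colourings that
are constant on connected components. -/
theorem split_iff_colorings {V : Type*} (G : SimpleGraph V) (u v : V) :
    (¬ G.Reachable u v ∧ ∀ w, G.Reachable u w ∨ G.Reachable v w) ↔
      (∃ c : V → Bool, (∀ a b, G.Adj a b → c a = c b) ∧ c u = true ∧ c v = false) ∧
        ∀ c : V → Bool, (∀ a b, G.Adj a b → c a = c b) → c u = true → c v = true →
          ∀ w, c w = true := by
  classical
  have const (c : V → Bool) (hc : ∀ a b, G.Adj a b → c a = c b) {a b : V}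
      (h : G.Reachable a b) : c a = c b := by
    obtain ⟨p⟩ := h
    induction p with
    | nil => rfl
    | cons h _ ih => exact (hc _ _ h).trans ih
  have step (x : V) {a b : V} (h : G.Adj a b) : G.Reachable x a ↔ G.Reachable x b :=
    ⟨fun hx => hx.trans h.reachable, fun hx => hx.trans h.symm.reachable⟩
  constructor
  · rintro ⟨huv, hw⟩
    refine ⟨⟨fun w => decide (G.Reachable u w), fun a b h => ?_, ?_, ?_⟩,
      fun c hc hu hv w => ?_⟩
    · simp [step u h]
    · simp
    · simpa using huv
    · rcases hw w with h | h
      · rw [← const c hc h, hu]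
      · rw [← const c hc h, hv]
  · rintro ⟨⟨c, hc, hu, hv⟩, hall⟩
    refine ⟨fun h => ?_, fun w => ?_⟩
    · have := const c hc h
      simp [hu, hv] at this
    · have := hall (fun w => decide (G.Reachable u w ∨ G.Reachable v w))
        (fun a b h => by simp [step u h, step v h]) (by simp) (by simp) w
      simpa using this

/-- Whether every listed edge joins two vertices of the same colour. -/
def isConstantOn (t : List (Fin 5 × Fin 5)) (c : Fin 5 → Bool) : Bool :=
  t.all fun e => c e.1 == c e.2

/-- Whether the listed edges split `Fin 5` into a component of `0` and a component of `1`. -/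
def isSplit (t : List (Fin 5 × Fin 5)) : Bool :=
  ([true, false].any fun x => [true, false].any fun y => [true, false].any fun z =>
      isConstantOn t ![true, false, x, y, z]) &&
    [true, false].all fun x => [true, false].all fun y => [true, false].all fun z =>
      !isConstantOn t ![true, true, x, y, z] || (x && y && z)

/-- The edges of `Hgraph 5`. -/
def edgePairs : List (Fin 5 × Fin 5) :=
  [(0, 2), (0, 3), (0, 4), (1, 2), (1, 3), (1, 4), (2, 3), (2, 4), (3, 4)]

theorem eq_vec_five (c : Fin 5 → Bool) : c = ![c 0, c 1, c 2, c 3, c 4] := by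
  ext i
  fin_cases i <;> rfl

theorem isConstantOn_iff (t : List (Fin 5 × Fin 5)) (c : Fin 5 → Bool) :
    isConstantOn t c = true ↔ ∀ a b,
      (SimpleGraph.fromEdgeSet ((t.map fun e => s(e.1, e.2)).toFinset : Set (Sym2 (Fin 5)))).Adj
        a b → c a = c b := by
  simp only [isConstantOn, List.all_eq_true, beq_iff_eq, SimpleGraph.fromEdgeSet_adj,
    Finset.mem_coe, List.mem_toFinset, List.mem_map]
  constructor
  · rintro h a b ⟨⟨e, he, hab⟩, -⟩
    rcases Sym2.eq_iff.mp hab with ⟨rfl, rfl⟩ | ⟨rfl, rfl⟩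
    · exact h e he
    · exact (h e he).symm
  · intro h e he
    by_cases hne : e.1 = e.2
    · rw [hne]
    · exact h _ _ ⟨⟨e, he, rfl⟩, hne⟩

theorem isSplit_iff (t : List (Fin 5 × Fin 5)) (G : SimpleGraph (Fin 5))
    (hG : G = SimpleGraph.fromEdgeSet
      ((t.map fun e => s(e.1, e.2)).toFinset : Set (Sym2 (Fin 5)))) :
    (¬ G.Reachable 0 1 ∧ ∀ w, G.Reachable 0 w ∨ G.Reachable 1 w) ↔ isSplit t = true := by
  subst hG
  rw [split_iff_colorings]
  simp only [← isConstantOn_iff]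
  rw [isSplit, Bool.and_eq_true]
  refine and_congr ?_ ?_
  · constructor
    · rintro ⟨c, hc, h0, h1⟩
      rw [eq_vec_five c, h0, h1] at hc
      simp only [List.any_eq_true]
      exact ⟨c 2, by simp, c 3, by simp, c 4, by simp, hc⟩
    · simp only [List.any_eq_true]
      rintro ⟨x, -, y, -, z, -, h⟩
      exact ⟨_, h, rfl, rfl⟩
  · simp only [List.all_eq_true, Bool.or_eq_true, Bool.not_eq_true', Bool.and_eq_true]
    constructor
    · intro h x _ y _ z _
      by_cases hc : isConstantOn t ![true, true, x, y, z] = true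
      · have := h _ hc rfl rfl
        exact Or.inr ⟨⟨this 2, this 3⟩, this 4⟩
      · exact Or.inl (by simpa using hc)
    · intro h c hc h0 h1
      have hc' := hc
      rw [eq_vec_five c, h0, h1] at hc'
      rcases h (c 2) (by simp) (c 3) (by simp) (c 4) (by simp) with h | ⟨⟨h2, h3⟩, h4⟩
      · simp [h] at hc'
      · intro w
        fin_cases w <;> assumption

theorem edgeFin_Hgraph_five_s16 :
    edgeFin (Hgraph 5) = (edgePairs.map fun e => s(e.1, e.2)).toFinset := by
  ext e
  induction e with | _ a b =>
  simp only [edgeFin, Set.Finite.mem_toFinset, SimpleGraph.mem_edgeSet, Hgraph,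
    SimpleGraph.deleteEdges_adj, SimpleGraph.top_adj, Set.mem_ofPred_eq]
  revert a b
  decide

theorem isSplit_lengths :
    (((edgePairs.sublists'.filter isSplit).map List.length : List ℕ) : Multiset ℕ) =
      Multiset.replicate 50 3 + Multiset.replicate 36 4 + Multiset.replicate 12 5 +
        Multiset.replicate 2 6 := by
  decide +kernel

/-- Explicit formula for the split reliability polynomial of `H_5 = K_5` minus an edge. -/
theorem split_H5 (q : ℝ) :
    Sfun 5 q = 2 * q ^ 3 * (1 - q) ^ 3 * (12 * q ^ 3 + 9 * q ^ 2 + 3 * q + 1) := by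
  have hnd : (edgePairs.map fun e => s(e.1, e.2)).Nodup := by decide
  have hcard : (edgePairs.map fun e => s(e.1, e.2)).toFinset.card = 9 := by
    rw [List.toFinset_card_of_nodup hnd]
    rfl
  have key : Sfun 5 q = ((edgePairs.sublists'.filter isSplit).map fun t =>
      (1 - q) ^ t.length * q ^ (9 - t.length)).sum := by
    have hite (l : List (List (Fin 5 × Fin 5))) (g : List (Fin 5 × Fin 5) → ℝ) :
        ((l.filter isSplit).map g).sum =
          (l.map fun t => if isSplit t = true then g t else 0).sum := by
      induction l with
      | nil => rfl
      | cons t l ih => by_cases h : isSplit t = true <;> simp [h, ih]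
    rw [Sfun, dif_pos (by norm_num), splitRel, edgeFin_Hgraph_five_s16, hcard,
      sum_powerset_toFinset _ hnd, List.sublists'_map, List.map_map, hite]
    refine congrArg List.sum (List.map_congr_left fun t ht => ?_)
    have htnd : (t.map fun e => s(e.1, e.2)).Nodup :=
      hnd.sublist ((List.mem_sublists'.mp ht).map _)
    rw [Function.comp_apply, List.toFinset_card_of_nodup htnd, List.length_map]
    by_cases h : isSplit t = true
    · rw [if_pos h]
      exact if_pos ((isSplit_iff t _ rfl).mpr h)
    · rw [if_neg h]
      exact if_neg (mt (isSplit_iff t _ rfl).mp h)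
  have hsum := congrArg (fun s : Multiset ℕ =>
    (s.map fun k => (1 - q) ^ k * q ^ (9 - k)).sum) isSplit_lengths
  simp only [Multiset.map_coe, Multiset.sum_coe, List.map_map, Function.comp_def,
    Multiset.map_add, Multiset.sum_add, Multiset.map_replicate, Multiset.sum_replicate] at hsum
  rw [key, hsum]
  simp only [nsmul_eq_mul]
  push_cast
  ring

end
end
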